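/- Let f : ℝ → ℝ be continuous, let u_L, u_R ∈ ℝ with u_L ≠ u_R, and let s ∈ ℝ. Define u : ℝ × (0,∞) → ℝ by u(x,t) = u_L if x ≤ s·t and u(x,t) = u_R if x > s·t, and define u₀ : ℝ → ℝ by u₀(x) = u_L if x ≤ 0 and u₀(x) = u_R if x > 0. Then u is a weak solution of u_t + (f(u))_x = 0 with initial data u₀ if and only if s = (f(u_L) − f(u_R))/(u_L − u_R) (the Rankine–Hugoniot condition). -/

import Mathlib

open MeasureTheory Set

/-- A bounded measurable function `u : ℝ × (0,∞) → ℝ` (represented as `u : ℝ → ℝ → ℝ`,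
`u x t`) is a weak solution of the scalar conservation law `u_t + (f(u))_x = 0` with
initial data `u₀` if for every smooth compactly supported test function `φ` one has
`∫_0^∞ ∫_ℝ (u ∂_t φ + f(u) ∂_x φ) dx dt + ∫_ℝ u₀(x) φ(x,0) dx = 0`. -/
def IsWeakSolution (f : ℝ → ℝ) (u : ℝ → ℝ → ℝ) (u₀ : ℝ → ℝ) : Prop :=
  ∀ φ : ℝ → ℝ → ℝ,
    ContDiff ℝ (⊤ : ℕ∞) (fun p : ℝ × ℝ => φ p.1 p.2) →
    HasCompactSupport (fun p : ℝ × ℝ => φ p.1 p.2) →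
    (∫ t in Ioi (0 : ℝ), ∫ x : ℝ,
        (u x t * deriv (fun s => φ x s) t + f (u x t) * deriv (fun y => φ y t) x))
      + ∫ x : ℝ, u₀ x * φ x 0 = 0

/-- Restricting a compactly supported function on the plane to a line `y ↦ (y, t)` preserves
compact support. -/
theorem HasCompactSupport.slice_left {g : ℝ × ℝ → ℝ} (hg : HasCompactSupport g) (t : ℝ) :
    HasCompactSupport fun y => g (y, t) := by
  refine HasCompactSupport.intro (hg.isCompact.image continuous_fst) fun y hy => ?_
  by_contra h
  exact hy ⟨(y, t), subset_tsupport _ h, rfl⟩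

/-- Restricting a compactly supported function on the plane to a line `t ↦ (y, t)` preserves
compact support. -/
theorem HasCompactSupport.slice_right {g : ℝ × ℝ → ℝ} (hg : HasCompactSupport g) (y : ℝ) :
    HasCompactSupport fun t => g (y, t) := by
  refine HasCompactSupport.intro (hg.isCompact.image continuous_snd) fun t ht => ?_
  by_contra h
  exact ht ⟨(y, t), subset_tsupport _ h, rfl⟩

theorem deriv_slice_left {g : ℝ × ℝ → ℝ} (hg : ContDiff ℝ 1 g) (y t : ℝ) :
    deriv (fun z => g (z, t)) y = fderiv ℝ g (y, t) (1, 0) := by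
  have h := ((hg.differentiable one_ne_zero) (y, t)).hasFDerivAt
  exact (h.comp_hasDerivAt y ((hasDerivAt_id y).prodMk (hasDerivAt_const y t))).deriv

theorem deriv_slice_right {g : ℝ × ℝ → ℝ} (hg : ContDiff ℝ 1 g) (y t : ℝ) :
    deriv (fun r => g (y, r)) t = fderiv ℝ g (y, t) (0, 1) := by
  have h := ((hg.differentiable one_ne_zero) (y, t)).hasFDerivAt
  exact (h.comp_hasDerivAt t ((hasDerivAt_const t y).prodMk (hasDerivAt_id t))).deriv

/-- Multiplying an integrable function by a measurable two-valued function keeps it integrable. -/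
theorem integrable_ite_const_mul {α : Type*} [MeasurableSpace α] {μ : Measure α} {h : α → ℝ}
    (hh : Integrable h μ) {P : α → Prop} [DecidablePred P] (hP : MeasurableSet {x | P x})
    (a b : ℝ) : Integrable (fun x => (if P x then a else b) * h x) μ := by
  refine hh.bdd_mul (c := max |a| |b|)
    (Measurable.ite hP measurable_const measurable_const).aestronglyMeasurable
    (Filter.Eventually.of_forall fun x => ?_)
  rw [Real.norm_eq_abs]
  split_ifs
  · exact le_max_left _ _
  · exact le_max_right _ _

theorem integrable_step_mul {g : ℝ × ℝ → ℝ} (hg : Continuous g) (hc : HasCompactSupport g)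
    (a b : ℝ) :
    Integrable (fun p : ℝ × ℝ => (if p.2 ≤ 0 then a else b) * g (p.2, p.1))
      ((volume.restrict (Ioi 0)).prod volume) := by
  have hi : Integrable (fun p : ℝ × ℝ => g (p.2, p.1)) (volume.prod volume) :=
    (hg.integrable_of_hasCompactSupport hc).swap
  have hi' : Integrable (fun p : ℝ × ℝ => g (p.2, p.1))
      ((volume.restrict (Ioi 0)).prod volume) :=
    hi.mono_measure (Measure.prod_mono Measure.restrict_le_self le_rfl)
  exact integrable_ite_const_mul hi' (measurableSet_le measurable_snd measurable_const) a b

theorem integral_integral_step_mul_deriv {g : ℝ × ℝ → ℝ} (hg : ContDiff ℝ 1 g)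
    (hc : HasCompactSupport g) (a b : ℝ) :
    ∫ t in Ioi (0 : ℝ), ∫ y : ℝ, (if y ≤ 0 then a else b) * fderiv ℝ g (y, t) (0, 1)
      = -∫ y : ℝ, (if y ≤ 0 then a else b) * g (y, 0) := by
  rw [integral_integral_swap (integrable_step_mul
    ((hg.continuous_fderiv one_ne_zero).clm_apply continuous_const) (hc.fderiv_apply ℝ (0, 1)) a b),
    ← integral_neg]
  congr 1 with y
  have hslice : ContDiff ℝ 1 fun r => g (y, r) :=
    hg.comp (by fun_prop : ContDiff ℝ 1 fun r => (y, r))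
  simp_rw [integral_const_mul, ← deriv_slice_right hg]
  rw [(hc.slice_right y).integral_Ioi_deriv_eq hslice 0]
  ring

theorem integral_step_mul_deriv {h : ℝ → ℝ} (hh : ContDiff ℝ 1 h) (hc : HasCompactSupport h)
    (a b : ℝ) :
    ∫ y : ℝ, (if y ≤ 0 then a else b) * deriv h y = (a - b) * h 0 := by
  have hi : Integrable (deriv h) :=
    (hh.continuous_deriv le_rfl).integrable_of_hasCompactSupport hc.deriv
  have hs : (fun y => (if y ≤ 0 then a else b) * deriv h y) =
      fun y => (Iic 0).indicator (fun y => a * deriv h y) y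
        + (Ioi 0).indicator (fun y => b * deriv h y) y := by
    ext y
    by_cases hy : y ≤ 0
    · simp [hy]
    · simp [hy, not_le.mp hy]
  rw [hs, integral_add ((hi.const_mul a).indicator measurableSet_Iic)
    ((hi.const_mul b).indicator measurableSet_Ioi), integral_indicator measurableSet_Iic,
    integral_indicator measurableSet_Ioi, integral_const_mul, integral_const_mul,
    hc.integral_Iic_deriv_eq hh, hc.integral_Ioi_deriv_eq hh]
  ring

/-- The weak residual of a two-state front moving at speed `s` is the Rankine–Hugoniot defect
times the integral of the test function along the front. -/
theorem riemann_shock_weak_residual (f : ℝ → ℝ) (uL uR s : ℝ) {φ : ℝ → ℝ → ℝ}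
    (hφ : ContDiff ℝ 1 fun p : ℝ × ℝ => φ p.1 p.2)
    (hc : HasCompactSupport fun p : ℝ × ℝ => φ p.1 p.2) :
    (∫ t in Ioi (0 : ℝ), ∫ x : ℝ,
        ((if x ≤ s * t then uL else uR) * deriv (fun r => φ x r) t
          + f (if x ≤ s * t then uL else uR) * deriv (fun y => φ y t) x))
      + ∫ x : ℝ, (if x ≤ 0 then uL else uR) * φ x 0
      = (f uL - f uR - s * (uL - uR)) * ∫ t in Ioi (0 : ℝ), φ (s * t) t := by
  let e : (ℝ × ℝ) ≃ₜ (ℝ × ℝ) :=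
    { toFun := fun p => (p.1 + s * p.2, p.2)
      invFun := fun p => (p.1 - s * p.2, p.2)
      left_inv := fun p => by simp
      right_inv := fun p => by simp
      continuous_toFun := by fun_prop
      continuous_invFun := by fun_prop }
  let g : ℝ × ℝ → ℝ := fun p => φ (p.1 + s * p.2) p.2
  have hg : ContDiff ℝ 1 g :=
    hφ.comp (f := fun p : ℝ × ℝ => (p.1 + s * p.2, p.2)) (by fun_prop)
  have hgc : HasCompactSupport g := hc.comp_homeomorph e
  have hx (y t : ℝ) : deriv (fun z => φ z t) (y + s * t) = deriv (fun z => g (z, t)) y :=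
    (deriv_comp_add_const (f := fun z => φ z t) (s * t) y).symm
  have ht (y t : ℝ) : deriv (fun r => φ (y + s * t) r) t
      = fderiv ℝ g (y, t) (0, 1) - s * deriv (fun z => g (z, t)) y := by
    have h := ((hφ.differentiable one_ne_zero) (y + s * t, t)).hasFDerivAt
    have hc : HasDerivAt (fun r => g (y, r))
        (fderiv ℝ (fun p : ℝ × ℝ => φ p.1 p.2) (y + s * t, t) (s, 1)) t := by
      refine h.comp_hasDerivAt t (f := fun r => (y + s * r, r)) ?_
      simpa using (((hasDerivAt_id t).const_mul s).const_add y).prodMk (hasDerivAt_id t)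
    rw [← deriv_slice_right hg, hc.deriv, ← hx, deriv_slice_left hφ, deriv_slice_right hφ,
      ← smul_eq_mul s (fderiv ℝ _ _ _), ← map_smul, ← map_sub]
    simp
  have hinner (t : ℝ) : ∫ x : ℝ,
        ((if x ≤ s * t then uL else uR) * deriv (fun r => φ x r) t
          + f (if x ≤ s * t then uL else uR) * deriv (fun y => φ y t) x)
      = (∫ y : ℝ, (if y ≤ 0 then uL else uR) * fderiv ℝ g (y, t) (0, 1))
        + (f uL - f uR - s * (uL - uR)) * φ (s * t) t := by
    have hslice : ContDiff ℝ 1 fun y => g (y, t) :=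
      hg.comp (by fun_prop : ContDiff ℝ 1 fun y => (y, t))
    have hd := integral_step_mul_deriv hslice (hgc.slice_left t) (f uL - s * uL) (f uR - s * uR)
    have hval : φ (s * t) t = g (0, t) := by simp [g]
    rw [← integral_add_right_eq_self _ (s * t), hval, show (f uL - f uR - s * (uL - uR))
      = f uL - s * uL - (f uR - s * uR) by ring, ← hd, ← integral_add]
    · congr 1 with y
      rw [ht, hx]
      by_cases hy : y ≤ 0
      · simp only [add_le_iff_nonpos_left, hy, if_true]
        ring
      · simp only [add_le_iff_nonpos_left, hy, if_false]
        ring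
    · exact integrable_ite_const_mul ((((hg.continuous_fderiv one_ne_zero).clm_apply
        continuous_const).comp (by fun_prop : Continuous fun y : ℝ => (y, t))).integrable_of_hasCompactSupport
        ((hgc.fderiv_apply ℝ (0, 1)).slice_left t)) measurableSet_Iic _ _
    · exact integrable_ite_const_mul ((hslice.continuous_deriv le_rfl).integrable_of_hasCompactSupport
        (hgc.slice_left t).deriv) measurableSet_Iic _ _
  simp_rw [hinner]
  rw [integral_add, integral_const_mul, integral_integral_step_mul_deriv hg hgc]
  · simp only [g, mul_zero, add_zero]
    ring
  · exact (integrable_step_mul ((hg.continuous_fderiv one_ne_zero).clm_apply continuous_const)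
      (hgc.fderiv_apply ℝ (0, 1)) uL uR).integral_prod_left
  · have : Integrable fun t => g (0, t) :=
      (hg.continuous.comp (by fun_prop : Continuous fun t : ℝ => ((0 : ℝ), t))
        ).integrable_of_hasCompactSupport (hgc.slice_right 0)
    simpa [g, IntegrableOn] using (this.const_mul _).integrableOn (s := Ioi 0)

/-- Some nonnegative test function has nonzero integral along the front `x = s t`, `t > 0`. -/
theorem exists_testFunction_integral_front_ne_zero (s : ℝ) :
    ∃ φ : ℝ → ℝ → ℝ, ContDiff ℝ (⊤ : ℕ∞) (fun p : ℝ × ℝ => φ p.1 p.2) ∧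
      HasCompactSupport (fun p : ℝ × ℝ => φ p.1 p.2) ∧
      ∫ t in Ioi (0 : ℝ), φ (s * t) t ≠ 0 := by
  let B : ContDiffBump ((s, 1) : ℝ × ℝ) := ⟨1 / 4, 1 / 2, by norm_num, by norm_num⟩
  refine ⟨fun x t => B (x, t), B.contDiff, B.hasCompactSupport, ?_⟩
  have hzero (t : ℝ) (ht : t ∉ Ioi (0 : ℝ)) : B (s * t, t) = 0 := by
    refine B.zero_of_le_dist (le_trans ?_ (le_max_right _ _))
    simp only [mem_Ioi, not_lt] at ht
    simp only [B, Real.dist_eq]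
    rw [abs_of_nonpos (by linarith)]
    linarith
  rw [setIntegral_eq_integral_of_forall_compl_eq_zero hzero]
  have hcont : Continuous fun t : ℝ => B (s * t, t) := B.continuous.comp (by fun_prop)
  refine (hcont.integral_pos_of_hasCompactSupport_nonneg_nonzero ?_ (fun t => B.nonneg)
    (x := 1) ?_).ne'
  · refine HasCompactSupport.intro (B.hasCompactSupport.isCompact.image continuous_snd)
      fun t ht => ?_
    by_contra h
    exact ht ⟨(s * t, t), subset_tsupport _ h, rfl⟩
  · rw [mul_one, B.one_of_mem_closedBall (Metric.mem_closedBall_self B.rIn_pos.le)]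
    exact one_ne_zero

/-- The piecewise-constant profile `u(x,t) = u_L` for `x ≤ s t`, `u_R` for `x > s t`, is a
weak solution of `u_t + (f(u))_x = 0` with Riemann initial data iff the Rankine–Hugoniot
condition `s = (f(u_L) - f(u_R))/(u_L - u_R)` holds. -/
theorem riemann_shock_weakSolution_iff_rankineHugoniot
    (f : ℝ → ℝ) (hf : Continuous f) (uL uR : ℝ) (hne : uL ≠ uR) (s : ℝ) :
    IsWeakSolution f (fun x t => if x ≤ s * t then uL else uR)
      (fun x => if x ≤ 0 then uL else uR)
      ↔ s = (f uL - f uR) / (uL - uR) := by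
  rw [eq_div_iff (sub_ne_zero.mpr hne)]
  constructor
  · intro h
    obtain ⟨φ, hφ, hc, hpos⟩ := exists_testFunction_integral_front_ne_zero s
    have h0 := h φ hφ hc
    rw [riemann_shock_weak_residual f uL uR s (hφ.of_le (by norm_cast)) hc] at h0
    exact (sub_eq_zero.mp ((mul_eq_zero.mp h0).resolve_right hpos)).symm
  · intro h φ hφ hc
    rw [riemann_shock_weak_residual f uL uR s (hφ.of_le (by norm_cast)) hc, h]
    ring
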